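/- Let N ≥ 1 be a natural number and let φ be a kinematic N-expansive continuous flow on a compact metric space X. Then the set of fixed points of φ, i.e., {σ ∈ X : φ(t, σ) = σ for all t ∈ ℝ}, is finite. -/

import Mathlib

/-- The set of fixed points of a kinematic `N`-expansive continuous
flow on a compact metric space is finite. -/
theorem kinematic_N_expansive_finite_fixed_points
    {X : Type*} [MetricSpace X] [CompactSpace X] (N : ℕ) (hN : 1 ≤ N)
    (φ : ℝ × X → X) (hφcont : Continuous φ)
    (hφ0 : ∀ x : X, φ (0, x) = x)
    (hφadd : ∀ s t : ℝ, ∀ x : X, φ (s, φ (t, x)) = φ (s + t, x))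
    (hexp : ∃ δ : ℝ, 0 < δ ∧ ∀ x : X,
      Set.encard {y : X | ∀ t : ℝ, dist (φ (t, x)) (φ (t, y)) ≤ δ} ≤ (N : ℕ∞)) :
    Set.Finite {σ : X | ∀ t : ℝ, φ (t, σ) = σ} := by
  obtain ⟨δ, hδ, h⟩ := hexp
  obtain ⟨t, -, htf, ht⟩ := finite_cover_balls_of_compact
    (isCompact_univ : IsCompact (Set.univ : Set X)) (half_pos hδ)
  have key : ∀ c ∈ t, ({σ : X | ∀ t : ℝ, φ (t, σ) = σ} ∩ Metric.ball c (δ / 2)).Finite := by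
    intro c _
    rcases Set.eq_empty_or_nonempty
      ({σ : X | ∀ t : ℝ, φ (t, σ) = σ} ∩ Metric.ball c (δ / 2)) with he | ⟨x, hx, hxc⟩
    · rw [he]
      exact Set.finite_empty
    · refine (Set.finite_of_encard_le_coe (h x)).subset ?_
      rintro y ⟨hy, hyc⟩ s
      rw [hx s, hy s]
      have h1 := dist_triangle_right x y c
      rw [Metric.mem_ball] at hxc hyc
      linarith
  refine (htf.biUnion key).subset ?_
  intro y hy
  obtain ⟨c, hc, hyc⟩ := Set.mem_iUnion₂.1 (ht (Set.mem_univ y))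
  exact Set.mem_iUnion₂.2 ⟨c, hc, hy, hyc⟩
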